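/- The time-ordering map intertwines differentials: T := exp(iℏ Δ_D) satisfies Q ∘ T = T ∘ Q_ℏ on Sym(𝔉_c(M)[1]), where Δ_D is the Laplacian of the Dirac pairing τ_D, Q_ℏ = Q + iℏ Δ_BV, and ∂Δ_D = Δ_BV. -/

import Mathlib

/-!
STATEMENT 18: The time-ordering map intertwines differentials:
`T := exp(iℏ Δ_D)` satisfies `Q ∘ T = T ∘ Q_ℏ` on `Sym(𝔉_c(M)[1])`, where
`Δ_D` is the Laplacian of the Dirac pairing `τ_D`, `Q_ℏ = Q + iℏ Δ_BV`, and
`∂Δ_D = Δ_BV`.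

Abstraction: `S` is the underlying ℂ-module of `Sym(𝔉_c(M)[1])`.  Since `Δ_D`
lowers the symmetric power by 2, it is locally nilpotent and the exponential
series truncates on every element; `T` is characterized by these truncated
sums.  The hypotheses `∂Δ_D = Q Δ_D − Δ_D Q = Δ_BV` and
`Δ_BV Δ_D = Δ_D Δ_BV` are those stated in the paper.
-/

/-- If `b = [q, d]` commutes with `d`, then `[q, d ^ (n + 1)] = (n + 1) d ^ n b`. -/
theorem mul_pow_eq_of_commutator_commute {R : Type*} [Ring R] {q d b : R}
    (hdel : q * d - d * q = b) (hcomm : b * d = d * b) (n : ℕ) :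
    q * d ^ (n + 1) = d ^ (n + 1) * q + ((n : R) + 1) * (d ^ n * b) := by
  have hqd : q * d = d * q + b := by rw [← hdel]; abel
  induction n with
  | zero => simp [hqd]
  | succ n ih =>
    have hbd : d ^ n * b * d = d ^ (n + 1) * b := by
      rw [mul_assoc, hcomm, ← mul_assoc, ← pow_succ]
    calc q * d ^ (n + 1 + 1) = q * d ^ (n + 1) * d := by rw [pow_succ d (n + 1), mul_assoc]
      _ = d ^ (n + 1) * (q * d) + ((n : R) + 1) * (d ^ n * b * d) := by
        rw [ih, add_mul, mul_assoc, mul_assoc ((n : R) + 1)]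
      _ = d ^ (n + 1 + 1) * q + (((n + 1 : ℕ) : R) + 1) * (d ^ (n + 1) * b) := by
        rw [hqd, hbd, mul_add, ← mul_assoc, ← pow_succ]
        push_cast
        simp only [add_mul, one_mul]
        abel

theorem time_ordering_map_intertwines_differentials
    (S : Type*) [AddCommGroup S] [Module ℂ S]
    (ℏ : ℝ) (hℏ : 0 < ℏ)
    (Q Δbv Δd : Module.End ℂ S)
    -- Δ_D is locally nilpotent (it lowers the symmetric power by 2)
    (hnil : ∀ a : S, ∃ N : ℕ, ∀ n ≥ N, (Δd ^ n) a = 0)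
    -- T = exp(iℏ Δ_D), defined by the (truncating) exponential series
    (T : Module.End ℂ S)
    (hT : ∀ (a : S) (N : ℕ), (∀ n ≥ N, (Δd ^ n) a = 0) →
      T a = ∑ n ∈ Finset.range N,
        ((Complex.I * (ℏ : ℂ)) ^ n / (n.factorial : ℂ)) • (Δd ^ n) a)
    -- ∂Δ_D = Δ_{∂τ_D} = Δ_BV  (Δ_D has degree 0, so ∂Δ_D is the commutator)
    (hdel : Q * Δd - Δd * Q = Δbv)
    -- graded commutation of the Laplacians Δ_BV and Δ_D
    (hcomm : Δbv * Δd = Δd * Δbv) :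
    -- Q ∘ T = T ∘ Q_ℏ with Q_ℏ = Q + iℏ Δ_BV
    Q * T = T * (Q + (Complex.I * (ℏ : ℂ)) • Δbv) := by
  have hpow (n : ℕ) (a : S) : Q ((Δd ^ (n + 1)) a) =
      (Δd ^ (n + 1)) (Q a) + ((n : ℂ) + 1) • (Δd ^ n) (Δbv a) := by
    have h := LinearMap.congr_fun (mul_pow_eq_of_commutator_commute hdel hcomm n) a
    have hcast : (n : Module.End ℂ S) + 1 = algebraMap ℂ (Module.End ℂ S) ((n : ℂ) + 1) := by
      simp
    rw [hcast] at h
    simpa only [Module.End.mul_apply, LinearMap.add_apply, Module.algebraMap_end_apply] using h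
  ext a
  obtain ⟨N₁, h₁⟩ := hnil a
  obtain ⟨N₂, h₂⟩ := hnil (Q a)
  obtain ⟨N₃, h₃⟩ := hnil (Δbv a)
  let N := N₁ + N₂ + N₃
  simp only [Module.End.mul_apply, LinearMap.add_apply, LinearMap.smul_apply, map_add, map_smul]
  rw [hT a (N + 1) fun n hn => h₁ n (by lia), hT (Q a) (N + 1) fun n hn => h₂ n (by lia),
    hT (Δbv a) N fun n hn => h₃ n (by lia), map_sum, Finset.sum_range_succ',
    Finset.sum_range_succ' _ N, Finset.smul_sum]
  simp only [map_smul, hpow, smul_add, Finset.sum_add_distrib, pow_zero, Module.End.one_apply]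
  rw [add_right_comm]
  congr 2
  funext n
  rw [smul_smul, smul_smul]
  congr 1
  have hn : (n : ℂ) + 1 ≠ 0 := Nat.cast_add_one_ne_zero n
  have hf : (n.factorial : ℂ) ≠ 0 := Nat.cast_ne_zero.mpr n.factorial_ne_zero
  rw [Nat.factorial_succ]
  push_cast
  field_simp
  exact pow_succ' _ n
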